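/- Let (R, m) be an analytically unramified Cohen-Macaulay local ring of dimension d > 0 with infinite residue field, I an m-primary ideal, and J a minimal reduction of I. If the Sally module of the normal filtration S̄ = ⊕_{n≥1} (closure(I^{n+1}))/(J^n · closure(I)) is nonzero, then its set of associated primes over the Rees algebra R(J) is exactly {m·R(J)}. -/

import Mathlib

set_option synthInstance.maxHeartbeats 1000000
set_option maxHeartbeats 2000000

open IsLocalRing Polynomial Finset

variable {R : Type*}

/-- `x` is integral over the ideal `I`: it satisfies an equation
`x^n + a₁ x^{n-1} + ⋯ + aₙ = 0` with `aᵢ ∈ Iⁱ`. -/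
def IsIntegralOverIdeal [CommRing R] (I : Ideal R) (x : R) : Prop :=
  ∃ n : ℕ, 0 < n ∧ ∃ a : ℕ → R, (∀ i ∈ Finset.Icc 1 n, a i ∈ I ^ i) ∧
    x ^ n + ∑ i ∈ Finset.Icc 1 n, a i * x ^ (n - i) = 0

/-- The integral closure of an ideal (the set of integral elements is an ideal,
so the span equals it). -/
def intCl [CommRing R] (I : Ideal R) : Ideal R :=
  Ideal.span {x | IsIntegralOverIdeal I x}

/-- Length of a module, as the Krull dimension of its lattice of submodules. -/
noncomputable def mlen (R M : Type*) [CommRing R] [AddCommGroup M] [Module R M] :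
    WithBot ℕ∞ :=
  Order.krullDim (Submodule R M)

/-- The quotient module `N/(K ∩ N)` for ideals `N K`. -/
abbrev idealQuot [CommRing R] (N K : Ideal R) :=
  N ⧸ (Submodule.comap N.subtype K)

/-- Depth of `M` with respect to the ideal `J`: sup of lengths of `M`-regular
sequences contained in `J`. -/
noncomputable def rdepth (A : Type*) [CommRing A] (J : Ideal A)
    (M : Type*) [AddCommGroup M] [Module A M] : ℕ∞ :=
  sSup {n : ℕ∞ | ∃ rs : List A, (rs.length : ℕ∞) = n ∧ (∀ x ∈ rs, x ∈ J) ∧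
    RingTheory.Sequence.IsRegular M rs}

/-- A local ring is Cohen-Macaulay if its depth equals its Krull dimension. -/
def IsCMLocal (R : Type*) [CommRing R] [IsLocalRing R] : Prop :=
  (rdepth R (maximalIdeal R) R : WithBot ℕ∞) = ringKrullDim R

/-- A local ring is analytically unramified if its `m`-adic completion is reduced. -/
def AnalyticallyUnramified (R : Type*) [CommRing R] [IsLocalRing R] : Prop :=
  IsReduced (AdicCompletion (maximalIdeal R) R)

/-- An ideal is `m`-primary. -/
def IsMPrimary [CommRing R] [IsLocalRing R] (I : Ideal R) : Prop :=
  I.radical = maximalIdeal R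

/-- `J ⊆ I` is a minimal reduction: generated by `d = dim R` elements and
`I^{n+1} = J I^n` for `n ≫ 0`. -/
def IsMinimalReduction [CommRing R] (d : ℕ) (J I : Ideal R) : Prop :=
  J ≤ I ∧ (∃ s : Fin d → R, J = Ideal.span (Set.range s)) ∧
    ∃ N : ℕ, ∀ n ≥ N, I ^ (n + 1) = J * I ^ n

/-- Normal Hilbert data: `L n = λ(R/ intCl(I^{n+1}))` and for `n ≫ 0` this agrees
with the polynomial whose normalized coefficients are the `e i`. -/
def NormalHilbertData [CommRing R] (d : ℕ) (I : Ideal R) (L : ℕ → ℕ) (e : ℕ → ℤ) : Prop :=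
  (∀ n, mlen R (R ⧸ intCl (I ^ (n + 1))) = (L n : WithBot ℕ∞)) ∧
    ∃ N : ℕ, ∀ n ≥ N, (L n : ℤ) =
      ∑ i ∈ Finset.range (d + 1), (-1 : ℤ) ^ i * e i * ((n + d - i).choose (d - i))

/-- `t` is the Cohen-Macaulay type of the local ring `R` of dimension `d`:
`t = λ((Q : m)/Q)` for every ideal `Q` generated by a maximal regular sequence in `m`. -/
def CMTypeData (R : Type*) [CommRing R] [IsLocalRing R] (d t : ℕ) : Prop :=
  ∀ s : List R, s.length = d → (∀ x ∈ s, x ∈ maximalIdeal R) →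
    RingTheory.Sequence.IsRegular R s →
      mlen R (idealQuot ((Ideal.span {x | x ∈ s}).colon (maximalIdeal R))
        (Ideal.span {x | x ∈ s})) = (t : WithBot ℕ∞)

/-- The quotient module `N/(K ∩ N)` for submodules `N K` of a module. -/
abbrev submoduleQuot {A M : Type*} [CommRing A] [AddCommGroup M] [Module A M]
    (N K : Submodule A M) :=
  N ⧸ (Submodule.comap N.subtype K)


namespace SallyAux
variable [CommRing R]

/-- homogeneous of degree `n` in the variables `< k`, coefficients in `Q` -/
def Good (k n : ℕ) (Q : Ideal R) (F : MvPolynomial ℕ R) : Prop :=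
  ∀ m, MvPolynomial.coeff m F ∈ Q ∧ (MvPolynomial.coeff m F ≠ 0 → m.degree = n ∧ ∀ i, k ≤ i → m i = 0)

def Jk (x : ℕ → R) (k : ℕ) : Ideal R := Ideal.span (x '' {i | i < k})

lemma Good.zero (k n : ℕ) (Q : Ideal R) : Good k n Q 0 := by
  intro m; simp

lemma Good.add {k n : ℕ} {Q : Ideal R} {F G : MvPolynomial ℕ R} (hF : Good k n Q F)
    (hG : Good k n Q G) : Good k n Q (F + G) := by
  intro m
  rw [MvPolynomial.coeff_add]
  refine ⟨Q.add_mem (hF m).1 (hG m).1, fun h => ?_⟩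
  by_cases h1 : MvPolynomial.coeff m F = 0
  · exact (hG m).2 (fun h2 => h (by rw [h1, h2, add_zero]))
  · exact (hF m).2 h1

lemma Good.C_mul {k n : ℕ} {Q : Ideal R} {F : MvPolynomial ℕ R} (hF : Good k n Q F) (r : R) :
    Good k n Q (MvPolynomial.C r * F) := by
  intro m
  rw [MvPolynomial.coeff_C_mul]
  exact ⟨Q.mul_mem_left _ (hF m).1, fun h => (hF m).2 (fun h2 => h (by rw [h2, mul_zero]))⟩

lemma Good.C_mul' {k n : ℕ} {P : Ideal R} {Q : Ideal R} {F : MvPolynomial ℕ R}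
    (hF : Good k n P F) {r : R} (hr : r ∈ Q) :
    Good k n Q (MvPolynomial.C r * F) := by
  intro m
  rw [MvPolynomial.coeff_C_mul]
  exact ⟨Q.mul_mem_right _ hr, fun h => (hF m).2 (fun h2 => h (by rw [h2, mul_zero]))⟩

lemma Good.mono {k k' n : ℕ} {Q Q' : Ideal R} {F : MvPolynomial ℕ R} (hF : Good k n Q F)
    (hk : k ≤ k') (hQ : Q ≤ Q') : Good k' n Q' F :=
  fun m => ⟨hQ (hF m).1, fun h => ⟨((hF m).2 h).1, fun i hi => ((hF m).2 h).2 i (hk.trans hi)⟩⟩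

lemma Good.mul {k n n' : ℕ} {Q Q' : Ideal R} {F G : MvPolynomial ℕ R} (hF : Good k n Q F)
    (hG : Good k n' Q' G) : Good k (n + n') Q' (F * G) := by
  classical
  intro m
  rw [MvPolynomial.coeff_mul]
  refine ⟨Q'.sum_mem fun c _ => Q'.mul_mem_left _ (hG _).1, fun h => ?_⟩
  obtain ⟨c, hc, hne⟩ := Finset.exists_ne_zero_of_sum_ne_zero h
  rw [Finset.HasAntidiagonal.mem_antidiagonal] at hc
  have h1 := (hF c.1).2 (left_ne_zero_of_mul hne)
  have h2 := (hG c.2).2 (right_ne_zero_of_mul hne)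
  rw [← hc]
  refine ⟨by rw [map_add, h1.1, h2.1], fun i hi => ?_⟩
  rw [Finsupp.add_apply, h1.2 i hi, h2.2 i hi]

lemma Good.X {k i : ℕ} (hi : i < k) : Good k 1 (⊤ : Ideal R) (MvPolynomial.X i) := by
  classical
  intro m
  refine ⟨trivial, fun h => ?_⟩
  rw [MvPolynomial.coeff_X] at h
  have : Finsupp.single i 1 = m := by
    by_contra h'; simp [h'] at h
  subst this
  refine ⟨by simp, fun j hj => ?_⟩
  rw [Finsupp.single_apply, if_neg (by omega)]

lemma exists_good (x : ℕ → R) (k : ℕ) (Q : Ideal R) (n : ℕ) {r : R}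
    (hr : r ∈ Q * Jk x k ^ n) : ∃ F, Good k n Q F ∧ MvPolynomial.eval x F = r := by
  induction n generalizing r with
  | zero =>
    refine ⟨MvPolynomial.C r, ?_, by simp⟩
    classical
    intro m
    rw [pow_zero, mul_one] at hr
    rw [MvPolynomial.coeff_C]
    split_ifs with h
    · subst h; simpa using hr
    · simp
  | succ n ih =>
    rw [pow_succ', mul_left_comm] at hr
    refine Submodule.mul_induction_on hr ?_ ?_
    · intro a ha b hb
      obtain ⟨F, hF, rfl⟩ := ih hb
      refine Submodule.span_induction (p := fun a _ => ∃ G, Good k (n+1) Q G ∧ MvPolynomial.eval x G = a * MvPolynomial.eval x F)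
        ?_ ?_ ?_ ?_ ha
      · rintro _ ⟨i, hi, rfl⟩
        refine ⟨MvPolynomial.X i * F, ?_, by simp⟩
        rw [add_comm]
        exact (Good.X hi).mul hF
      · exact ⟨0, Good.zero _ _ _, by simp⟩
      · rintro a b - - ⟨G, hG, h1⟩ ⟨H, hH, h2⟩
        exact ⟨G + H, hG.add hH, by rw [map_add, h1, h2, add_mul]⟩
      · rintro c a - ⟨G, hG, h1⟩
        exact ⟨MvPolynomial.C c * G, hG.C_mul c, by rw [map_mul, h1, MvPolynomial.eval_C, smul_eq_mul, mul_assoc]⟩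
    · rintro a b ⟨G, hG, h1⟩ ⟨H, hH, h2⟩
      exact ⟨G + H, hG.add hH, by rw [map_add, h1, h2]⟩

lemma prod_mem (x : ℕ → R) (k : ℕ) (m : ℕ →₀ ℕ) (hm : ∀ i, k ≤ i → m i = 0) :
    (m.prod fun i e => x i ^ e) ∈ Jk x k ^ m.degree := by
  rw [Finsupp.prod, Finsupp.degree_apply, ← Finset.prod_pow_eq_pow_sum]
  refine Ideal.prod_mem_prod fun i hi => ?_
  refine Ideal.pow_mem_pow (Ideal.subset_span (?_ : x i ∈ x '' {i | i < k})) _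
  refine ⟨i, ?_, rfl⟩
  by_contra h
  exact (Finsupp.mem_support_iff.mp hi) (hm i (not_lt.mp h))

lemma Good.eval_mem {x : ℕ → R} {k n : ℕ} {Q : Ideal R} {F : MvPolynomial ℕ R}
    (hF : Good k n Q F) : MvPolynomial.eval x F ∈ Q * Jk x k ^ n := by
  rw [MvPolynomial.eval_eq]
  refine Ideal.sum_mem _ fun m hm => ?_
  have h := (hF m).2 (MvPolynomial.mem_support_iff.mp hm)
  refine Ideal.mul_mem_mul (hF m).1 ?_
  rw [← h.1]
  exact prod_mem x k m h.2

/-- Regularity of the sequence. -/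
def Reg (x : ℕ → R) (d : ℕ) : Prop := ∀ k < d, ∀ r, x k * r ∈ Jk x k → r ∈ Jk x k

lemma Jk_mono (x : ℕ → R) {k k' : ℕ} (h : k ≤ k') : Jk x k ≤ Jk x k' :=
  Ideal.span_mono (Set.image_mono fun _ hi => lt_of_lt_of_le hi h)

lemma mem_Jk (x : ℕ → R) {i k : ℕ} (h : i < k) : x i ∈ Jk x k := Ideal.subset_span ⟨i, h, rfl⟩

def QR (x : ℕ → R) (k : ℕ) : Prop :=
  ∀ n F, Good k n ⊤ F → MvPolynomial.eval x F = 0 → ∀ m, MvPolynomial.coeff m F ∈ Jk x k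

lemma QR.strong {x : ℕ → R} {k n : ℕ} {Q F} (h : ∀ F, Good k n ⊤ F → MvPolynomial.eval x F = 0 → ∀ m, MvPolynomial.coeff m F ∈ Jk x k)
    (hQ : Jk x k ≤ Q) (hF : Good k n ⊤ F)
    (hx : MvPolynomial.eval x F ∈ Q * Jk x k ^ n) (m) : MvPolynomial.coeff m F ∈ Q := by
  obtain ⟨G, hG, hx'⟩ := exists_good x k Q n hx
  have := h (F + MvPolynomial.C (-1) * G) (hF.add ((hG.C_mul _).mono le_rfl le_top)) (by simp [hx']) m
  rw [MvPolynomial.coeff_add, MvPolynomial.coeff_C_mul] at this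
  have h2 := Q.sub_mem (hQ this) (Q.mul_mem_left (-1) (hG m).1)
  simpa using h2

lemma QR.regular_pow {x : ℕ → R} {k : ℕ} (h : QR x k)
    (hr : ∀ r, x k * r ∈ Jk x k → r ∈ Jk x k) (j : ℕ) (r : R) (hxr : x k * r ∈ Jk x k ^ j) :
    r ∈ Jk x k ^ j := by
  induction j with
  | zero => simp
  | succ j ih =>
    have h1 := ih (Ideal.pow_le_pow_right (Nat.le_succ j) hxr)
    rw [← one_mul (Jk x k ^ j)] at h1
    obtain ⟨F, hF, rfl⟩ := exists_good x k _ j h1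
    rw [Ideal.one_eq_top] at hF
    have h2 := QR.strong (Q := Jk x k) (F := MvPolynomial.C (x k) * F) (h j) le_rfl (hF.C_mul _)
      (by rw [← pow_succ']; simpa using hxr)
    have h3 : Good k j (Jk x k) F := fun m => ⟨hr _ (by simpa [MvPolynomial.coeff_C_mul] using h2 m), (hF m).2⟩
    rw [pow_succ']
    exact h3.eval_mem

lemma Reg.qr {x : ℕ → R} {d : ℕ} (h : Reg x d) : ∀ k ≤ d, QR x k := by
  classical
  intro k
  induction k with
  | zero =>
    intro _ n F hF hx m
    have : F = MvPolynomial.C (MvPolynomial.coeff 0 F) := by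
      ext m
      rw [MvPolynomial.coeff_C]
      split_ifs with hm
      · rw [hm]
      · by_contra h0
        exact hm (Finsupp.ext fun i => (((hF m).2 h0).2 i (Nat.zero_le _)).symm)
    rw [this, MvPolynomial.eval_C] at hx
    rw [this, hx]; simp
  | succ k ih =>
    intro hk
    have ihk := ih (by omega)
    have hreg := h k (by omega)
    intro n
    induction n with
    | zero =>
      intro F hF hx m
      have : F = MvPolynomial.C (MvPolynomial.coeff 0 F) := by
        ext m
        rw [MvPolynomial.coeff_C]
        split_ifs with hm
        · rw [hm]
        · by_contra h0
          exact hm (((Finsupp.degree_eq_zero_iff _).mp ((hF m).2 h0).1).symm)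
      rw [this, MvPolynomial.eval_C] at hx
      rw [this, hx]; simp
    | succ n ihn =>
      intro F hF hx
      set s : ℕ →₀ ℕ := Finsupp.single k 1 with hs
      set H := MvPolynomial.divMonomial F s with hH
      set G := MvPolynomial.modMonomial F s with hG
      have hFe : F = MvPolynomial.X k * H + G := (MvPolynomial.divMonomial_add_modMonomial_single F k).symm
      have hHg : Good (k+1) n ⊤ H := by
        intro m
        refine ⟨trivial, fun hm => ?_⟩
        rw [hH, MvPolynomial.coeff_divMonomial] at hm
        have := (hF _).2 hm
        rw [map_add] at this
        refine ⟨by have h3 := this.1; rw [hs, Finsupp.degree_single] at h3; omega, fun i hi => ?_⟩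
        have h2 := this.2 i hi
        rw [Finsupp.add_apply] at h2
        omega
      have hGg : Good k (n+1) ⊤ G := by
        intro m
        refine ⟨trivial, fun hm => ?_⟩
        by_cases hsm : s ≤ m
        · exact absurd (MvPolynomial.coeff_modMonomial_of_le _ hsm) hm
        · rw [hG, MvPolynomial.coeff_modMonomial_of_not_le _ hsm] at hm
          have := (hF _).2 hm
          refine ⟨this.1, fun i hi => ?_⟩
          rcases Nat.eq_or_lt_of_le hi with rfl | hi
          · by_contra h0
            apply hsm
            rw [hs, Finsupp.single_le_iff]
            omega
          · exact this.2 i hi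
      have hx' : x k * MvPolynomial.eval x H + MvPolynomial.eval x G = 0 := by
        rw [hFe] at hx; simpa using hx
      have hHe : MvPolynomial.eval x H ∈ Jk x k ^ (n+1) := by
        apply QR.regular_pow ihk hreg
        rw [eq_neg_of_add_eq_zero_left hx']
        apply neg_mem
        have := hGg.eval_mem (x := x)
        rwa [← Ideal.one_eq_top, one_mul] at this
      have hHc : ∀ m, MvPolynomial.coeff m H ∈ Jk x (k+1) := by
        refine QR.strong (ihn) le_rfl hHg ?_
        rw [← pow_succ']
        exact Ideal.pow_right_mono (Jk_mono x (Nat.le_succ k)) _ hHe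
      rw [← one_mul (Jk x k ^ (n+1)), Ideal.one_eq_top] at hHe
      obtain ⟨h', hh', he⟩ := exists_good x k _ _ hHe
      have hGc := ihk (n+1) (G + MvPolynomial.C (x k) * h') (hGg.add (hh'.C_mul _)) (by
        simp [he]; rw [add_comm]; exact hx')
      intro m
      rw [hFe, MvPolynomial.coeff_add]
      refine add_mem ?_ ?_
      · rw [MvPolynomial.coeff_X_mul']
        split_ifs
        · exact hHc _
        · simp
      · have h1 := Jk_mono x (Nat.le_succ k) (hGc m)
        rw [MvPolynomial.coeff_add, MvPolynomial.coeff_C_mul] at h1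
        have h2 := (Jk x (k+1)).sub_mem h1 ((Jk x (k+1)).mul_mem_right (MvPolynomial.coeff m h') (mem_Jk x (Nat.lt_succ_self k)))
        simpa using h2

open IsLocalRing in
lemma coeffs_mem [IsLocalRing R] {F D : MvPolynomial ℕ R} {Q : Ideal R} 
    (hF : ∃ m, MvPolynomial.coeff m F ∉ maximalIdeal R)
    (hm : ∀ r ∈ maximalIdeal R, ∀ m, r * MvPolynomial.coeff m D ∈ Q)
    (hFD : ∀ m, MvPolynomial.coeff m (F * D) ∈ Q) (m) : MvPolynomial.coeff m D ∈ Q := by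
  classical
  by_contra hD
  obtain ⟨m', hF⟩ := hF
  set A := F.support.filter fun m => MvPolynomial.coeff m F ∉ maximalIdeal R
  set B := D.support.filter fun m => MvPolynomial.coeff m D ∉ Q
  have hA : ∀ a, a ∈ A ↔ MvPolynomial.coeff a F ∉ maximalIdeal R := by
    intro a
    simp only [A, Finset.mem_filter, MvPolynomial.mem_support_iff, and_iff_right_iff_imp]
    intro h h0; exact h (by simp [h0])
  have hB : ∀ a, a ∈ B ↔ MvPolynomial.coeff a D ∉ Q := by
    intro a
    simp only [B, Finset.mem_filter, MvPolynomial.mem_support_iff, and_iff_right_iff_imp]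
    intro h h0; exact h (by simp [h0])
  obtain ⟨a, ha, b, hb, hu⟩ := UniqueSums.uniqueAdd_of_nonempty (A := A) (B := B)
    ⟨m', (hA _).2 hF⟩ ⟨m, (hB _).2 hD⟩
  have h1 := hFD (a + b)
  rw [MvPolynomial.coeff_mul, ← Finset.add_sum_erase _ _ (Finset.HasAntidiagonal.mem_antidiagonal.mpr rfl : (a, b) ∈ _)] at h1
  have h2 : ∑ c ∈ (Finset.HasAntidiagonal.antidiagonal (a+b)).erase (a, b), MvPolynomial.coeff c.1 F * MvPolynomial.coeff c.2 D ∈ Q := by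
    refine Q.sum_mem fun c hc => ?_
    rw [Finset.mem_erase, Finset.HasAntidiagonal.mem_antidiagonal] at hc
    by_cases hcA : c.1 ∈ A
    · by_cases hcB : c.2 ∈ B
      · have := hu hcA hcB hc.2
        exact absurd (Prod.ext this.1 this.2) hc.1
      · rw [hB, not_not] at hcB
        exact Q.mul_mem_left _ hcB
    · rw [hA, not_not] at hcA
      exact hm _ hcA _
  have h3 := (Q.add_mem_iff_left h2).mp h1
  have hu : IsUnit (MvPolynomial.coeff a F) := by
    have := (hA a).1 ha
    rwa [mem_maximalIdeal, mem_nonunits_iff, not_not] at this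
  exact (hB b).1 hb ((Ideal.unit_mul_mem_iff_mem Q hu).mp h3)

open IsLocalRing in
lemma key [IsLocalRing R] {x : ℕ → R} {d : ℕ} (h : Reg x d) {Q : Ideal R} (hQ : Jk x d ≤ Q)
    {a c : R} {s k : ℕ}
    (ha : a ∈ Jk x d ^ s) (ha' : a ∉ maximalIdeal R * Jk x d ^ s)
    (hc : c ∈ Jk x d ^ k) (hmc : ∀ r ∈ maximalIdeal R, r * c ∈ Q * Jk x d ^ k)
    (hac : a * c ∈ Q * Jk x d ^ (s + k)) : c ∈ Q * Jk x d ^ k := by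
  have hqr := h.qr d le_rfl
  rw [← one_mul (Jk x d ^ _), Ideal.one_eq_top] at ha hc
  obtain ⟨F, hF, rfl⟩ := exists_good x d _ _ ha
  obtain ⟨D, hD, rfl⟩ := exists_good x d _ _ hc
  have : Good d k Q D := by
    refine fun m => ⟨?_, (hD m).2⟩
    refine coeffs_mem (F := F) ?_ ?_ ?_ m
    · by_contra! hcon
      exact ha' (Good.eval_mem fun m => ⟨hcon m, (hF m).2⟩)
    · intro r hr m
      rw [← MvPolynomial.coeff_C_mul]
      exact QR.strong (hqr _) hQ (hD.C_mul r) (by simpa using hmc r hr) m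
    · exact fun m => QR.strong (hqr _) hQ (hF.mul hD) (by simpa using hac) m
  exact this.eval_mem

open IsLocalRing in
lemma key2 [IsLocalRing R] {x : ℕ → R} {d : ℕ} (h : Reg x d) {Q : Ideal R} (hQ : Jk x d ≤ Q)
    {a c : R} {s n : ℕ}
    (ha : a ∈ Jk x d ^ s) (ha' : a ∉ maximalIdeal R * Jk x d ^ s)
    (hmc : ∀ r ∈ maximalIdeal R, r * c ∈ Q * Jk x d ^ n)
    (hac : a * c ∈ Q * Jk x d ^ (s + n)) : c ∈ Q * Jk x d ^ n := by
  have hc : ∀ k ≤ n, c ∈ Jk x d ^ k := by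
    intro k
    induction k with
    | zero => simp
    | succ k ih =>
      intro hk
      rw [pow_succ']
      refine key (a := a) (s := s) h le_rfl ha ha' (ih (by omega)) ?_ ?_
      · intro r hr
        rw [← pow_succ']
        have h1 : r * c ∈ Jk x d ^ n :=
          (Ideal.mul_le_right : Q * Jk x d ^ n ≤ Jk x d ^ n) (hmc r hr)
        exact Ideal.pow_le_pow_right hk h1
      · rw [← pow_succ']
        have h1 : a * c ∈ Jk x d ^ (s + n) :=
          (Ideal.mul_le_right : Q * Jk x d ^ (s + n) ≤ Jk x d ^ (s + n)) hac
        have h2 : s + k + 1 ≤ s + n := by omega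
        exact Ideal.pow_le_pow_right h2 h1
  exact key h hQ ha ha' (hc n le_rfl) hmc hac

open IsLocalRing in
lemma key3 [IsLocalRing R] {x : ℕ → R} {d : ℕ} (h : Reg x d) {J Q : Ideal R} (hJ : Jk x d = J)
    (hQ : J ≤ Q) {a c : R} {s n : ℕ}
    (ha : a ∈ J ^ s) (ha' : a ∉ maximalIdeal R * J ^ s)
    (hmc : ∀ r ∈ maximalIdeal R, r * c ∈ Q * J ^ n)
    (hac : a * c ∈ Q * J ^ (s + n)) : c ∈ Q * J ^ n := by
  subst hJ
  exact key2 h hQ ha ha' hmc hac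


open RingTheory.Sequence CategoryTheory Abelian IsLocalRing

universe u

lemma exists_coset_avoid {A : Type*} [CommRing A] {S : Set (Ideal A)} (hS : S.Finite)
    (hp : ∀ p ∈ S, p.IsPrime) (x : A) (L : Ideal A)
    (h : ∀ p ∈ S, ¬ (x ∈ p ∧ L ≤ p)) : ∃ a ∈ L, ∀ p ∈ S, x + a ∉ p := by
  classical
  set B := {p | Maximal (· ∈ S) p ∧ x ∉ p} with hB
  set T := {p | Maximal (· ∈ S) p ∧ x ∈ p} with hT
  have hBf : B.Finite := hS.subset fun p hp => hp.1.1
  have hTf : T.Finite := hS.subset fun p hp => hp.1.1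
  have hnot : ¬ (((L ⊓ ∏ p ∈ hBf.toFinset, p : Ideal A) : Set A) ⊆ ⋃ p ∈ T, (p : Set A)) := by
    refine (Ideal.subset_union_prime_finite hTf (f := id) 0 0 (fun p h _ _ => hp p h.1.1)).not.mpr ?_
    rintro ⟨p, hpT, hle⟩
    have hpp := hp p hpT.1.1
    rcases hpp.inf_le.mp hle with h1 | h1
    · exact h p hpT.1.1 ⟨hpT.2, h1⟩
    · obtain ⟨q, hq, hqp⟩ := (hpp.prod_le).mp h1
      have hqB : q ∈ B := hBf.mem_toFinset.mp hq
      exact hqB.2 (hqB.1.2 hpT.1.1 hqp hpT.2)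
  obtain ⟨a, ha, ha'⟩ := Set.not_subset.mp hnot
  refine ⟨a, ha.1, fun p hpS hx => ?_⟩
  obtain ⟨q, hpq, hq⟩ := hS.exists_le_maximal hpS
  have hxq := hpq hx
  by_cases hxq' : x ∈ q
  · exact ha' (Set.mem_biUnion (⟨hq, hxq'⟩ : q ∈ T) ((Ideal.add_mem_iff_right _ hxq').mp hxq))
  · have haq : a ∈ q := by
      have h2 : ∏ p ∈ hBf.toFinset, p ≤ q :=
        ((hp q hq.1).prod_le).mpr ⟨q, hBf.mem_toFinset.mpr ⟨hq, hxq'⟩, le_rfl⟩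
      exact h2 ha.2
    exact hxq' ((Ideal.add_mem_iff_left _ haq).mp hxq)

lemma smul_top_lt {A : Type u} [CommRing A] [IsLocalRing A] {J : Ideal A} (hJ : J ≤ maximalIdeal A)
    (M : Type u) [AddCommGroup M] [Module A M] [Module.Finite A M] [Nontrivial M] :
    J • (⊤ : Submodule A M) < ⊤ := by
  refine lt_top_iff_ne_top.mpr fun h => ?_
  have := Submodule.eq_bot_of_le_smul_of_le_jacobson_bot J (⊤ : Submodule A M)
    Module.Finite.fg_top h.ge (hJ.trans (IsLocalRing.maximalIdeal_le_jacobson _))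
  exact top_ne_bot this

lemma exists_regular_gens {A : Type u} [CommRing A] [IsLocalRing A] [IsNoetherianRing A]
    (J : Ideal A) (hJ : J ≤ maximalIdeal A) (xs : List A) :
    ∀ (K : Ideal A) (M : Type u) [AddCommGroup M] [Module A M] [Module.Finite A M],
      K ≤ Module.annihilator A M → K ⊔ Ideal.ofList xs = J →
      (∃ rs : List A, rs.length = xs.length ∧ (∀ r ∈ rs, r ∈ J) ∧ IsRegular M rs) →
      ∃ zs : List A, zs.length = xs.length ∧ IsWeaklyRegular M zs ∧ K ⊔ Ideal.ofList zs = J := by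
  induction xs with
  | nil =>
    intro K M _ _ _ _ hKJ _
    exact ⟨[], rfl, IsWeaklyRegular.nil A M, hKJ⟩
  | cons x xs ih =>
    rintro K M _ _ _ hKM hKJ ⟨rs, hlen, hrs, hreg⟩
    have : Nontrivial M := hreg.nontrivial
    obtain ⟨a, ha, hav⟩ := exists_coset_avoid (associatedPrimes.finite A M) (fun p hp => hp.1) x
      (Ideal.ofList xs) (by
        rintro p hp ⟨hx, hL⟩
        have hJp : J ≤ p := by
          rw [← hKJ, Ideal.ofList_cons]
          refine sup_le (hKM.trans (Submodule.annihilator_top (R := A) (M := M) ▸ IsAssociatedPrime.annihilator_le hp)) (sup_le ?_ hL)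
          rwa [Ideal.span_singleton_le_iff_mem]
        match rs, hlen with
        | r :: rs, _ =>
          have h1 : r ∈ ({ r : A | IsSMulRegular M r }ᶜ : Set A) := by
            rw [← biUnion_associatedPrimes_eq_compl_regular]
            exact Set.mem_biUnion hp (hJp (hrs r (by simp)))
          exact h1 ((isRegular_cons_iff M r rs).mp hreg).1)
    set y := x + a with hy
    have hyreg : IsSMulRegular M y := by
      by_contra hcon
      have h1 : y ∈ ({ r : A | IsSMulRegular M r }ᶜ : Set A) := hcon
      rw [← biUnion_associatedPrimes_eq_compl_regular] at h1
      obtain ⟨p, hp, hyp⟩ := Set.mem_iUnion₂.mp h1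
      exact hav p hp hyp
    have hspan : Ideal.span {y} ⊔ Ideal.ofList xs = Ideal.ofList (x :: xs) := by
      rw [Ideal.ofList_cons]
      apply le_antisymm
      · refine sup_le ?_ le_sup_right
        rw [Ideal.span_singleton_le_iff_mem]
        exact add_mem (Ideal.mem_sup_left (Ideal.mem_span_singleton_self x)) (Ideal.mem_sup_right ha)
      · refine sup_le ?_ le_sup_right
        rw [Ideal.span_singleton_le_iff_mem, show x = y - a by rw [hy]; ring]
        exact sub_mem (Ideal.mem_sup_left (Ideal.mem_span_singleton_self y)) (Ideal.mem_sup_right ha)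
    have hyJ : y ∈ J := by
      rw [← hKJ, ← hspan]
      exact Ideal.mem_sup_right (Ideal.mem_sup_left (Ideal.mem_span_singleton_self y))
    have hM' : Nontrivial (QuotSMulTop y M) :=
      nontrivial_quotSMulTop_of_mem_maximalIdeal M (hJ hyJ)
    have e1 := (ModuleCat.exists_isRegular_tfae J (xs.length + 1) (ModuleCat.of A M)
      (smul_top_lt hJ M)).out 3 1
    have hext := e1.mp ⟨rs, by simpa using hlen, hrs, hreg⟩
    have e2 := (ModuleCat.exists_isRegular_tfae J xs.length (ModuleCat.of A (QuotSMulTop y M))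
      (smul_top_lt hJ _)).out 1 3
    have hrs' := e2.mp (by
        intro i hi
        have zero1 := AddCommGrpCat.isZero_of_iff_subsingleton.mpr (hext i (by omega))
        have zero2 := AddCommGrpCat.isZero_of_iff_subsingleton.mpr (hext (i + 1) (by omega))
        have hsc : IsSMulRegular (ModuleCat.of A M) y := hyreg
        exact AddCommGrpCat.subsingleton_of_isZero <| ShortComplex.Exact.isZero_of_both_zeros
          ((Ext.covariant_sequence_exact₃' _ hsc.smulShortComplex_shortExact) i (i + 1) rfl)
          (zero1.eq_zero_of_src _) (zero2.eq_zero_of_tgt _))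
    obtain ⟨zs, hz1, hz2, hz3⟩ := ih (K ⊔ Ideal.span {y}) (QuotSMulTop y M) (by
        refine sup_le ?_ ?_
        · refine hKM.trans ?_
          exact LinearMap.annihilator_le_of_surjective (Submodule.mkQ _) (Submodule.mkQ_surjective _)
        · rw [Ideal.span_singleton_le_iff_mem, Module.mem_annihilator]
          intro m
          obtain ⟨m, rfl⟩ := Submodule.mkQ_surjective _ m
          rw [← map_smul, Submodule.mkQ_apply, Submodule.Quotient.mk_eq_zero]
          exact Submodule.smul_mem_pointwise_smul _ _ _ trivial)
      (by rw [sup_assoc, hspan, hKJ]) hrs'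
    refine ⟨y :: zs, by simpa using hz1, (isWeaklyRegular_cons_iff M y zs).mpr ⟨hyreg, hz2⟩, ?_⟩
    rw [Ideal.ofList_cons, ← sup_assoc, hz3]

lemma exists_Reg {A : Type u} [CommRing A] [IsLocalRing A] [IsNoetherianRing A]
    {J : Ideal A} (hJ : J.radical = maximalIdeal A) {d : ℕ} (s : Fin d → A)
    (hs : J = Ideal.span (Set.range s))
    (hdep : ∃ rs : List A, rs.length = d ∧ (∀ r ∈ rs, r ∈ maximalIdeal A) ∧ IsRegular A rs) :
    ∃ x : ℕ → A, Reg x d ∧ Jk x d = J := by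
  have hJm : J ≤ maximalIdeal A := hJ ▸ Ideal.le_radical
  have hdep' : ∃ rs : List A, rs.length = d ∧ (∀ r ∈ rs, r ∈ J) ∧ IsRegular A rs := by
    have e1 := (ModuleCat.exists_isRegular_tfae (maximalIdeal A) d (ModuleCat.of A A)
      (smul_top_lt le_rfl A)).out 3 0
    have h1 := e1.mp hdep
    have hsupp : Module.support A (A ⧸ J) = PrimeSpectrum.zeroLocus J := by
      rw [Module.support_eq_zeroLocus, Ideal.annihilator_quotient]
    have hn : Nontrivial (A ⧸ J) := Ideal.Quotient.nontrivial_iff.mpr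
      (fun h => (maximalIdeal.isMaximal A).ne_top (top_le_iff.mp (h ▸ hJm)))
    have e2 := (ModuleCat.exists_isRegular_tfae J d (ModuleCat.of A A)
      (smul_top_lt hJm A)).out 2 3
    refine e2.mp ⟨ModuleCat.of A (A ⧸ J), hn, inferInstance, hsupp, ?_⟩
    refine h1 _ hn inferInstance ?_
    rw [hsupp, PrimeSpectrum.zeroLocus_subset_zeroLocus_iff, hJ]
  obtain ⟨zs, hz1, hz2, hz3⟩ := exists_regular_gens J hJm (List.ofFn s) ⊥ A bot_le (by
    rw [bot_sup_eq, hs, Ideal.ofList]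
    congr 1
    ext r
    simp [List.mem_ofFn]) (by simpa using hdep')
  rw [List.length_ofFn] at hz1
  rw [bot_sup_eq] at hz3
  have hJk : ∀ k ≤ d, Jk (fun i => zs.getD i 0) k = Ideal.ofList (zs.take k) := by
    intro k hk
    rw [Jk, Ideal.ofList]
    congr 1
    ext r
    simp only [Set.mem_image, Set.mem_ofPred_eq, List.mem_take_iff_getElem]
    constructor
    · rintro ⟨i, hi, rfl⟩
      exact ⟨i, by omega, by rw [List.getD_eq_getElem]⟩
    · rintro ⟨i, hi, rfl⟩
      exact ⟨i, by omega, by rw [List.getD_eq_getElem]⟩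
  refine ⟨fun i => zs.getD i 0, fun k hk r hr => ?_, ?_⟩
  · rw [hJk k hk.le] at hr ⊢
    have h1 := hz2.regular_mod_prev k (by omega)
    rw [smul_eq_mul, Ideal.mul_top] at h1
    refine mem_of_isSMulRegular_quotient_of_smul_mem h1 ?_
    simpa [List.getD_eq_getElem, hz1, hk] using hr
  · rw [hJk d le_rfl, ← hz1, List.take_length, hz3]

end SallyAux

namespace SallyAux

lemma mem_map_rees {A : Type*} [CommRing A] (J m : Ideal A) (g : reesAlgebra J)
    (h : ∀ n, (g : Polynomial A).coeff n ∈ m * J ^ n) :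
    g ∈ Ideal.map (algebraMap A (reesAlgebra J)) m := by
  have key : ∀ n r, r ∈ m * J ^ n → ∃ g' : reesAlgebra J, (g' : Polynomial A) = monomial n r ∧
      g' ∈ Ideal.map (algebraMap A (reesAlgebra J)) m := by
    intro n r hr
    refine Submodule.mul_induction_on hr ?_ ?_
    · intro a ha b hb
      refine ⟨algebraMap A (reesAlgebra J) a * ⟨monomial n b, reesAlgebra.monomial_mem.mpr hb⟩,
        ?_, Ideal.mul_mem_right _ _ (Ideal.mem_map_of_mem _ ha)⟩
      change Polynomial.C a * monomial n b = _
      rw [Polynomial.C_mul_monomial]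
    · rintro a b ⟨g1, h1, h1'⟩ ⟨g2, h2, h2'⟩
      exact ⟨g1 + g2, by rw [map_add, ← h1, ← h2]; rfl, add_mem h1' h2'⟩
  choose G hG hG' using fun n => key n _ (h n)
  have : g = ∑ n ∈ (g : Polynomial A).support, G n := by
    apply Subtype.ext
    rw [AddSubmonoidClass.coe_finsetSum]
    simp_rw [hG]
    exact Polynomial.as_sum_support _
  rw [this]
  exact Ideal.sum_mem _ fun n _ => hG' n

lemma le_intCl {A : Type*} [CommRing A] (I : Ideal A) : I ≤ intCl I := by
  intro x hx
  refine Ideal.subset_span ⟨1, one_pos, fun _ => -x, ?_, ?_⟩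
  · intro i hi
    rw [Finset.Icc_self, Finset.mem_singleton] at hi
    subst hi
    simpa using hx
  · simp

end SallyAux

theorem sally_assoc_primes
    (R : Type*) [CommRing R] [IsLocalRing R] [IsNoetherianRing R]
    (d : ℕ) (hd : 0 < d) (hdim : ringKrullDim R = d)
    (hCM : IsCMLocal R) (hAU : AnalyticallyUnramified R)
    (hres : Infinite (ResidueField R))
    (I J : Ideal R) (hI : IsMPrimary I) (hJ : IsMinimalReduction d J I)
    (N₁ N₂ : Submodule (reesAlgebra J) (Polynomial R))
    (h₁ : ∀ p : Polynomial R, p ∈ N₁ ↔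
      (p.coeff 0 = 0 ∧ ∀ n, 1 ≤ n → p.coeff n ∈ intCl (I ^ (n + 1))))
    (h₂ : ∀ p : Polynomial R, p ∈ N₂ ↔
      (p.coeff 0 = 0 ∧ ∀ n, 1 ≤ n → p.coeff n ∈ J ^ n * intCl I))
    (hnz : Nontrivial (submoduleQuot N₁ N₂)) :
    associatedPrimes (reesAlgebra J) (submoduleQuot N₁ N₂) =
      {Ideal.map (algebraMap R (reesAlgebra J)) (maximalIdeal R)} := by
  classical
  obtain ⟨hJI, ⟨s, hs⟩, N, hN⟩ := hJ
  have hJrad : J.radical = maximalIdeal R := by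
    apply le_antisymm
    · rw [← hI]; exact Ideal.radical_mono hJI
    · rw [← hI, ← Ideal.radical_pow (I := I) (n := N + 1) (Nat.succ_ne_zero N)]
      refine Ideal.radical_mono ?_
      rw [hN N le_rfl]
      exact Ideal.mul_le_left
  have hdep : ∃ rs : List R, rs.length = d ∧ (∀ r ∈ rs, r ∈ maximalIdeal R) ∧
      RingTheory.Sequence.IsRegular R rs := by
    have h := hCM
    rw [IsCMLocal, hdim] at h
    have h' : rdepth R (maximalIdeal R) R = (d : ℕ∞) := by exact_mod_cast h
    have hne : Nonempty {n : ℕ∞ | ∃ rs : List R, (rs.length : ℕ∞) = n ∧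
        (∀ x ∈ rs, x ∈ maximalIdeal R) ∧ RingTheory.Sequence.IsRegular R rs} :=
      ⟨⟨0, [], by simp, by simp, RingTheory.Sequence.IsRegular.nil R R⟩⟩
    have hmem := ENat.sSup_mem_of_nonempty_of_lt_top (by
      change rdepth R (maximalIdeal R) R < ⊤
      rw [h']; exact ENat.natCast_lt_top d)
    change rdepth R (maximalIdeal R) R ∈ _ at hmem
    rw [h'] at hmem
    obtain ⟨rs, h1, h2, h3⟩ := hmem
    exact ⟨rs, by exact_mod_cast h1, h2, h3⟩
  obtain ⟨x, hreg, hJx⟩ := SallyAux.exists_Reg hJrad s hs hdep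
  set Q := intCl I with hQ
  have hJQ : J ≤ Q := hJI.trans (SallyAux.le_intCl I)
  refine Set.eq_singleton_iff_nonempty_unique_mem.mpr ⟨associatedPrimes.nonempty _ _, ?_⟩
  intro P hP
  obtain ⟨hPp, z, hz⟩ := isAssociatedPrime_iff.mp hP
  obtain ⟨f, rfl⟩ := Submodule.mkQ_surjective _ z
  have hf0 : (f : Polynomial R).coeff 0 = 0 := ((h₁ _).mp f.2).1
  have hmemP : ∀ g : reesAlgebra J, g ∈ P ↔
      ∀ n, ((g : Polynomial R) * (f : Polynomial R)).coeff n ∈ Q * J ^ n := by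
    intro g
    have e1 : g ∈ P ↔ (g : Polynomial R) * (f : Polynomial R) ∈ N₂ := by
      rw [hz, Submodule.mem_colon_singleton, Submodule.mem_bot, ← map_smul, Submodule.mkQ_apply,
        Submodule.Quotient.mk_eq_zero]
      rfl
    rw [e1, h₂]
    have h0 : ((g : Polynomial R) * (f : Polynomial R)).coeff 0 = 0 := by
      rw [Polynomial.mul_coeff_zero, hf0, mul_zero]
    constructor
    · rintro ⟨-, h⟩ n
      rcases Nat.eq_zero_or_pos n with rfl | hn
      · rw [h0]; exact zero_mem _
      · rw [mul_comm Q]; exact h n hn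
    · intro h
      refine ⟨h0, fun n _ => ?_⟩
      rw [mul_comm (J ^ n)]; exact h n
  have hmP : ∀ r ∈ maximalIdeal R, algebraMap R (reesAlgebra J) r ∈ P := by
    intro r hr
    rw [← hJrad] at hr
    obtain ⟨e, he⟩ := hr
    refine hPp.mem_of_pow_mem (e * ((f : Polynomial R).natDegree + 1)) ?_
    rw [← map_pow, hmemP]
    intro n
    change (Polynomial.C (r ^ (e * ((f : Polynomial R).natDegree + 1))) * (f : Polynomial R)).coeff n ∈ _
    rw [Polynomial.coeff_C_mul]
    by_cases hn : n ≤ (f : Polynomial R).natDegree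
    · refine Ideal.mul_mem_right _ _ ?_
      rw [pow_mul]
      have h1 : (r ^ e) ^ ((f : Polynomial R).natDegree + 1) ∈ J ^ (n + 1) :=
        Ideal.pow_le_pow_right (by omega) (Ideal.pow_mem_pow he _)
      rw [pow_succ'] at h1
      exact Ideal.mul_mono_left hJQ h1
    · rw [Polynomial.coeff_eq_zero_of_natDegree_lt (by omega), mul_zero]
      exact zero_mem _
  have hmf : ∀ r ∈ maximalIdeal R, ∀ n, r * (f : Polynomial R).coeff n ∈ Q * J ^ n := by
    intro r hr n
    have := (hmemP _).mp (hmP r hr) n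
    change (Polynomial.C r * (f : Polynomial R)).coeff n ∈ _ at this
    rwa [Polynomial.coeff_C_mul] at this
  apply le_antisymm
  · intro g hg
    by_contra hcon
    have hex : ∃ n, (g : Polynomial R).coeff n ∉ maximalIdeal R * J ^ n := by
      by_contra! h
      exact hcon (SallyAux.mem_map_rees J _ g h)
    have hn0 := Nat.find_spec hex
    have hlt : ∀ i < Nat.find hex, (g : Polynomial R).coeff i ∈ maximalIdeal R * J ^ i :=
      fun i hi => not_not.mp (Nat.find_min hex hi)
    set n0 := Nat.find hex with hn0def
    have hfn : ∀ n, (f : Polynomial R).coeff n ∈ Q * J ^ n := by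
      intro n
      induction n using Nat.strong_induction_on with
      | _ n ih =>
      have h1 := (hmemP g).mp hg (n0 + n)
      rw [Polynomial.coeff_mul, ← Finset.add_sum_erase _ _
        (Finset.HasAntidiagonal.mem_antidiagonal.mpr rfl : (n0, n) ∈ _)] at h1
      have h2 : ∑ c ∈ (Finset.HasAntidiagonal.antidiagonal (n0 + n)).erase (n0, n),
          (g : Polynomial R).coeff c.1 * (f : Polynomial R).coeff c.2 ∈ Q * J ^ (n0 + n) := by
        refine Ideal.sum_mem _ fun c hc => ?_
        rw [Finset.mem_erase, Finset.HasAntidiagonal.mem_antidiagonal] at hc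
        obtain ⟨hne, hsum⟩ := hc
        rw [← hsum]
        rcases lt_trichotomy c.1 n0 with h | h | h
        · have h3 := hlt _ h
          refine Submodule.mul_induction_on h3 ?_ ?_
          · intro a ha b hb
            have h4 := Ideal.mul_mem_mul hb (hmf a ha c.2)
            rw [mul_left_comm, ← pow_add] at h4
            convert h4 using 1
            ring
          · intro a b ha hb
            rw [add_mul]
            exact add_mem ha hb
        · exact absurd (Prod.ext h (by change c.2 = n; omega)) hne
        · have h4 := Ideal.mul_mem_mul (g.2 c.1) (ih c.2 (by omega))
          rwa [mul_left_comm, ← pow_add] at h4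
      have h3 := (Ideal.add_mem_iff_left _ h2).mp h1
      have h4 := g.2 n0
      exact SallyAux.key3 hreg hJx hJQ h4 hn0 (fun r hr => hmf r hr n) h3
    refine hPp.ne_top ((Ideal.eq_top_iff_one _).mpr ((hmemP 1).mpr fun n => ?_))
    change ((1 : Polynomial R) * (f : Polynomial R)).coeff n ∈ _
    rw [one_mul]
    exact hfn n
  · rw [Ideal.map_le_iff_le_comap]
    exact fun r hr => hmP r hr
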